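/- Let p_X be the Gaussian distribution N(μ_X, σ_X²) with σ_X > 0, and let R, R_c ∈ [0,∞], P ∈ [0,∞). Then D(R,R_c,P|W₂²) ≥ D̲'(R,R_c,P|W₂²), where D̲'(R,R_c,P|W₂²) := min over σ̂ ∈ [max{σ_X − √P, 0}, σ_X] of sup over α > 0 of [ σ_X² + σ̂² − 2 σ_X √((1 − e^{−2R})(σ̂² − δ₊(σ̂,α)²)) ], with δ₊(σ̂,α) := (max{σ_X e^{−(R+R_c)} − √(σ_X² − α(σ_X² + σ̂² − P) + α² σ̂²), 0})/α; moreover this minimum over σ̂ is attained. -/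

import Mathlib

open MeasureTheory ProbabilityTheory Real Set
open scoped ENNReal NNReal

noncomputable section

open Classical in
/-- Kullback-Leibler divergence of `q` from `p`, in `[0,∞]`. -/
def KLD {α : Type*} [MeasurableSpace α] (q p : Measure α) : ℝ≥0∞ :=
  if q ≪ p ∧ Integrable (fun x => Real.log (q.rnDeriv p x).toReal) q
  then ENNReal.ofReal (∫ x, Real.log (q.rnDeriv p x).toReal ∂q) else ⊤

/-- Mutual information between `f` and `g` under `μ`. -/
def mutInfo {Ω α β : Type*} [MeasurableSpace Ω] [MeasurableSpace α] [MeasurableSpace β]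
    (μ : Measure Ω) (f : Ω → α) (g : Ω → β) : ℝ≥0∞ :=
  KLD (μ.map (fun ω => (f ω, g ω))) ((μ.map f).prod (μ.map g))

/-- Squared Wasserstein-2 distance. -/
def W2sq (p q : Measure ℝ) : ℝ≥0∞ :=
  ⨅ (cpl : Measure (ℝ × ℝ)) (_ : IsProbabilityMeasure cpl) (_ : cpl.map Prod.fst = p)
    (_ : cpl.map Prod.snd = q), ∫⁻ xy, ENNReal.ofReal ((xy.1 - xy.2) ^ 2) ∂cpl

/-- `exp(-x)` for `x ∈ [0,∞]`, with `exp(-∞) = 0`. -/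
def expNeg (x : ℝ≥0∞) : ℝ := if x = ⊤ then 0 else Real.exp (-x.toReal)

/-- Feasibility predicate for the distortion-rate-perception function. -/
def DRPfeasible (pX : Measure ℝ) (φ : Measure ℝ → Measure ℝ → ℝ≥0∞) (R Rc P : ℝ≥0∞)
    (μ : Measure (ℝ × ℝ × ℝ)) : Prop :=
  ∃ hμ : IsProbabilityMeasure μ,
    μ.map (fun w => w.1) = pX ∧
    (haveI := hμ
     CondIndepFun (MeasurableSpace.comap (fun w : ℝ × ℝ × ℝ => w.2.1) inferInstance)
      ((measurable_fst.comp measurable_snd).comap_le)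
      (fun w : ℝ × ℝ × ℝ => w.1) (fun w : ℝ × ℝ × ℝ => w.2.2) μ) ∧
    mutInfo μ (fun w => w.1) (fun w => w.2.1) ≤ R ∧
    mutInfo μ (fun w => w.2.2) (fun w => w.2.1) ≤ R + Rc ∧
    φ pX (μ.map (fun w => w.2.2)) ≤ P

/-- Mean squared distortion of a joint law of `(X, U, X̂)`. -/
def distortion (μ : Measure (ℝ × ℝ × ℝ)) : ℝ≥0∞ :=
  ∫⁻ w, ENNReal.ofReal ((w.1 - w.2.2) ^ 2) ∂μ

/-- The distortion-rate-perception function `D(R, R_c, P | φ)`. -/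
def DRP (pX : Measure ℝ) (φ : Measure ℝ → Measure ℝ → ℝ≥0∞) (R Rc P : ℝ≥0∞) : ℝ≥0∞ :=
  ⨅ (μ : Measure (ℝ × ℝ × ℝ)) (_ : DRPfeasible pX φ R Rc P μ), distortion μ

/-- `D(R, R_c, ∞)`: the DRP function without perception constraint. -/
def DRPinf (pX : Measure ℝ) (R Rc : ℝ≥0∞) : ℝ≥0∞ :=
  DRP pX (fun _ _ => 0) R Rc ⊤

/-- Deterministic-decoder (entropy-constrained quantization) function `D_e(R, R_c)`,
with `H(X̂) := I(X̂; X̂)`. -/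
def De (pX : Measure ℝ) (R Rc : ℝ≥0∞) : ℝ≥0∞ :=
  ⨅ (cpl : Measure (ℝ × ℝ)) (_ : IsProbabilityMeasure cpl ∧ cpl.map Prod.fst = pX ∧
      mutInfo cpl Prod.fst Prod.snd ≤ R ∧ mutInfo cpl Prod.snd Prod.snd ≤ R + Rc),
    ∫⁻ w, ENNReal.ofReal ((w.1 - w.2) ^ 2) ∂cpl

/-- The Gaussian measure `N(μ, σ²)`. -/
def gauss (μ σ : ℝ) : Measure ℝ := gaussianReal μ ⟨σ ^ 2, sq_nonneg σ⟩

end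
noncomputable section

/-- `ξ(R, R_c) = √((1 - e^{-2R})(1 - e^{-2(R+R_c)}))`. -/
def xiRRc (R Rc : ℝ≥0∞) : ℝ :=
  Real.sqrt ((1 - expNeg (2 * R)) * (1 - expNeg (2 * (R + Rc))))

/-- `ψ(σ) = log(σ_X/σ) + (σ² - σ_X²)/(2σ_X²)`. -/
def psi (σX s : ℝ) : ℝ := Real.log (σX / s) + (s ^ 2 - σX ^ 2) / (2 * σX ^ 2)

/-- `δ₊(σ̂, α)` from the improved lower bound. -/
def deltaPlus (σX : ℝ) (R Rc : ℝ≥0∞) (P s α : ℝ) : ℝ :=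
  max (σX * expNeg (R + Rc) -
    Real.sqrt (σX ^ 2 - α * (σX ^ 2 + s ^ 2 - P) + α ^ 2 * s ^ 2)) 0 / α

/-- The inner `sup` over `α > 0` in the improved lower bound `D̲'`. -/
def DlowerPrimeFun (σX : ℝ) (R Rc : ℝ≥0∞) (P s : ℝ) : ℝ :=
  sSup ((fun α => σX ^ 2 + s ^ 2 - 2 * σX *
    Real.sqrt ((1 - expNeg (2 * R)) * (s ^ 2 - deltaPlus σX R Rc P s α ^ 2))) '' Set.Ioi 0)

/-- The improved explicit lower bound `D̲'(R, R_c, P | W₂²)`. -/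
def DlowerPrime (σX : ℝ) (R Rc : ℝ≥0∞) (P : ℝ) : ℝ :=
  sInf (DlowerPrimeFun σX R Rc P '' Set.Icc (max (σX - Real.sqrt P) 0) σX)

/-- The explicit lower bound `D̲(R, R_c, P | W₂²)` of Xie et al. -/
def DlowerW2 (σX : ℝ) (R Rc : ℝ≥0∞) (P : ℝ) : ℝ :=
  sInf ((fun s => σX ^ 2 + s ^ 2 - 2 * σX *
      Real.sqrt ((1 - expNeg (2 * R)) *
        (s ^ 2 - max (σX * expNeg (R + Rc) - Real.sqrt P) 0 ^ 2)))
    '' Set.Icc (max (σX - Real.sqrt P) 0) σX)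

end


lemma dv_aux {α β : Type*} [MeasurableSpace α] [MeasurableSpace β] (P Q : Measure α)
    [IsProbabilityMeasure P] [IsProbabilityMeasure Q] (κ : Kernel α β) [IsMarkovKernel κ]
    (hPQ : P ≪ Q) (hlog : Integrable (fun x => Real.log (P.rnDeriv Q x).toReal) P)
    (g : α × β → ℝ) (hg : Measurable g) (hgi : Integrable g (P ⊗ₘ κ))
    (hQ : ∫⁻ w, ENNReal.ofReal (Real.exp (g w)) ∂(Q ⊗ₘ κ) ≤ 1) :
    ∫ w, g w ∂(P ⊗ₘ κ) ≤ ∫ x, Real.log (P.rnDeriv Q x).toReal ∂P := by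
  set f := P.rnDeriv Q with hf
  have hfm : Measurable f := Measure.measurable_rnDeriv _ _
  have hpos : ∀ᵐ a ∂P, 0 < f a := Measure.rnDeriv_pos hPQ
  have hlt : ∀ᵐ a ∂P, f a < ∞ := hPQ.ae_le (Measure.rnDeriv_lt_top P Q)
  let h : α × β → ℝ := fun w => Real.exp (g w - Real.log (f w.1).toReal)
  have hm : Measurable h := by
    apply Real.measurable_exp.comp
    exact hg.sub (Real.measurable_log.comp (hfm.comp measurable_fst).ennreal_toReal)
  have hge : Measurable (fun w => ENNReal.ofReal (Real.exp (g w))) := by fun_prop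
  let G : α → ℝ≥0∞ := fun a => ∫⁻ b, ENNReal.ofReal (Real.exp (g (a, b))) ∂(κ a)
  have hG : Measurable G := Measurable.lintegral_kernel_prod_right' hge
  have h1 : ∫⁻ w, ENNReal.ofReal (h w) ∂(P ⊗ₘ κ) ≤ 1 := by
    rw [Measure.lintegral_compProd (by fun_prop)]
    calc ∫⁻ a, ∫⁻ b, ENNReal.ofReal (h (a, b)) ∂(κ a) ∂P
        = ∫⁻ a, (f a)⁻¹ * G a ∂P := by
          apply lintegral_congr_ae
          filter_upwards [hpos, hlt] with a ha hb
          have hr : 0 < (f a).toReal := ENNReal.toReal_pos ha.ne' hb.ne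
          rw [← lintegral_const_mul _ (by fun_prop)]
          apply lintegral_congr
          intro b
          simp only [h]
          rw [Real.exp_sub, Real.exp_log hr, div_eq_inv_mul, ENNReal.ofReal_mul (by positivity),
            ENNReal.ofReal_inv_of_pos hr, ENNReal.ofReal_toReal hb.ne]
      _ = ∫⁻ a, f a * ((f a)⁻¹ * G a) ∂Q := by
          rw [lintegral_rnDeriv_mul hPQ]
          exact (hfm.inv.mul hG).aemeasurable
      _ ≤ ∫⁻ a, G a ∂Q := by
          apply lintegral_mono
          intro a
          dsimp only
          rw [← mul_assoc]
          calc f a * (f a)⁻¹ * G a ≤ 1 * G a := by gcongr; exact ENNReal.mul_inv_le_one _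
            _ = G a := one_mul _
      _ ≤ 1 := by
          rw [Measure.lintegral_compProd hge] at hQ
          exact hQ
  have hi : Integrable h (P ⊗ₘ κ) := by
    refine ⟨hm.aestronglyMeasurable, ?_⟩
    rw [hasFiniteIntegral_iff_ofReal (Filter.Eventually.of_forall fun w => (Real.exp_pos _).le)]
    exact h1.trans_lt ENNReal.one_lt_top
  have h2 : ∫ w, h w ∂(P ⊗ₘ κ) ≤ 1 := by
    rw [integral_eq_lintegral_of_nonneg_ae (Filter.Eventually.of_forall fun w => (Real.exp_pos _).le)
      hm.aestronglyMeasurable]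
    exact ENNReal.toReal_le_of_le_ofReal zero_le_one (by simpa using h1)
  have hfst : (P ⊗ₘ κ).map Prod.fst = P := Measure.fst_compProd P κ
  have hL : Integrable (fun w : α × β => Real.log (f w.1).toReal) (P ⊗ₘ κ) := by
    rw [← hfst] at hlog
    exact hlog.comp_measurable measurable_fst
  have hL2 : ∫ w, Real.log (f w.1).toReal ∂(P ⊗ₘ κ) = ∫ x, Real.log (f x).toReal ∂P := by
    conv_rhs => rw [← hfst]
    rw [integral_map measurable_fst.aemeasurable]
    exact (Real.measurable_log.comp hfm.ennreal_toReal).aestronglyMeasurable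
  have h3 : ∫ w, (g w - Real.log (f w.1).toReal) ∂(P ⊗ₘ κ) ≤ ∫ w, (h w - 1) ∂(P ⊗ₘ κ) := by
    apply integral_mono (hgi.sub hL) (hi.sub (integrable_const _))
    intro w
    have := Real.add_one_le_exp (g w - Real.log (f w.1).toReal)
    change g w - Real.log (f w.1).toReal ≤ Real.exp (g w - Real.log (f w.1).toReal) - 1
    linarith
  rw [integral_sub hgi hL, integral_sub hi (integrable_const _), hL2] at h3
  simp at h3
  linarith

lemma gauss_eq (μ σ : ℝ) : gauss μ σ = gaussianReal μ (Real.toNNReal (σ ^ 2)) := by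
  rw [gauss]
  congr 1
  ext
  rw [Real.coe_toNNReal _ (sq_nonneg σ)]
  rfl

instance gauss_prob (μ σ : ℝ) : IsProbabilityMeasure (gauss μ σ) := by
  rw [gauss_eq]; infer_instance

lemma gauss_memLp (μ σ : ℝ) : MemLp (fun x => x) 2 (gauss μ σ) := by
  rw [gauss_eq]
  exact memLp_id_gaussianReal' 2 (by simp)

lemma gauss_mean (μ σ : ℝ) : ∫ x, x ∂(gauss μ σ) = μ := by
  rw [gauss_eq]
  exact integral_id_gaussianReal

lemma gauss_int (μX σX : ℝ) : Integrable (fun x => (x - μX) ^ 2) (gauss μX σX) :=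
  ((gauss_memLp μX σX).sub (memLp_const μX)).integrable_sq

lemma gauss_var (μX σX : ℝ) : ∫ x, (x - μX) ^ 2 ∂(gauss μX σX) = σX ^ 2 := by
  have h := variance_fun_id_gaussianReal (μ := μX) (v := Real.toNNReal (σX ^ 2))
  rw [variance_eq_integral (by fun_prop), Real.coe_toNNReal _ (sq_nonneg σX), ← gauss_eq,
    gauss_mean] at h
  exact h

lemma core_pdf (μX σX d m x : ℝ) (hσ : 0 < σX) (hd : 0 < d) :
    ENNReal.ofReal (Real.exp (-(x - m) ^ 2 / (2 * d) + (x - μX) ^ 2 / (2 * σX ^ 2)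
      + (Real.log σX - Real.log d / 2))) * gaussianPDF μX (Real.toNNReal (σX ^ 2)) x
      = gaussianPDF m (Real.toNNReal d) x := by
  simp only [gaussianPDF_def]
  rw [← ENNReal.ofReal_mul (Real.exp_pos _).le]
  congr 1
  rw [gaussianPDFReal, gaussianPDFReal]
  rw [Real.coe_toNNReal _ (sq_nonneg σX), Real.coe_toNNReal _ hd.le]
  have e1 : Real.exp (Real.log σX - Real.log d / 2) = σX / √d := by
    rw [Real.exp_sub, Real.exp_log hσ, ← Real.log_sqrt hd.le, Real.exp_log (by positivity)]
  have e2 : √(2 * π * σX ^ 2) = √(2 * π) * σX := by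
    rw [Real.sqrt_mul (by positivity), Real.sqrt_sq hσ.le]
  have e3 : √(2 * π * d) = √(2 * π) * √d := by
    rw [Real.sqrt_mul (by positivity)]
  rw [Real.exp_add, e1, e2, e3]
  have e4 : Real.exp (-(x - m) ^ 2 / (2 * d) + (x - μX) ^ 2 / (2 * σX ^ 2))
      * Real.exp (-(x - μX) ^ 2 / (2 * σX ^ 2)) = Real.exp (-(x - m) ^ 2 / (2 * d)) := by
    rw [← Real.exp_add]; congr 1; ring
  have h1 : 0 < √(2 * π) := by positivity
  have h2 : 0 < √d := by positivity
  rw [← e4]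
  field_simp

lemma core_bound (μX σX : ℝ) (hσ : 0 < σX) (P : Measure (ℝ × ℝ)) (pA pU : Measure ℝ)
    [IsProbabilityMeasure P] [IsProbabilityMeasure pA] [IsProbabilityMeasure pU]
    (hPA : P.map Prod.fst = pA)
    (κ : Kernel ℝ ℝ) [IsMarkovKernel κ] (hG : pA.bind κ = gauss μX σX)
    (m : ℝ → ℝ) (hm : Measurable m) (R : ℝ≥0∞) (hR : KLD P (pA.prod pU) ≤ R)
    (hint : Integrable (fun w : (ℝ × ℝ) × ℝ => (w.2 - m w.1.2) ^ 2)
      (P ⊗ₘ κ.comap Prod.fst measurable_fst)) :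
    σX ^ 2 * expNeg R ^ 2 ≤
      ∫ w : (ℝ × ℝ) × ℝ, (w.2 - m w.1.2) ^ 2 ∂(P ⊗ₘ κ.comap Prod.fst measurable_fst) := by
  set P3 := P ⊗ₘ κ.comap Prod.fst measurable_fst with hP3
  set D := ∫ w : (ℝ × ℝ) × ℝ, (w.2 - m w.1.2) ^ 2 ∂P3 with hD
  have hD0 : 0 ≤ D := integral_nonneg fun w => sq_nonneg _
  by_cases hRt : R = ⊤
  · simp [expNeg, hRt, hD0]
  have hac : P ≪ pA.prod pU ∧
      Integrable (fun x => Real.log (P.rnDeriv (pA.prod pU) x).toReal) P := by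
    by_contra hc
    rw [KLD, if_neg hc] at hR
    exact hRt (top_le_iff.mp hR)
  rw [KLD, if_pos hac] at hR
  have hR' : ∫ x, Real.log (P.rnDeriv (pA.prod pU) x).toReal ∂P ≤ R.toReal := by
    rw [← ENNReal.ofReal_le_iff_le_toReal hRt]; exact hR
  have hv : Real.toNNReal (σX ^ 2) ≠ 0 := by
    have : 0 < Real.toNNReal (σX ^ 2) := Real.toNNReal_pos.mpr (by positivity)
    exact this.ne'
  -- law of the last coordinate
  have hlaw : P3.map Prod.snd = gauss μX σX := by
    rw [← hG]
    ext s hs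
    rw [Measure.map_apply measurable_snd hs, hP3, Measure.compProd_apply (measurable_snd hs),
      Measure.bind_apply hs κ.aemeasurable, ← hPA,
      lintegral_map (κ.measurable_coe hs) measurable_fst]
    rfl
  have hgint := gauss_int μX σX
  have hgval := gauss_var μX σX
  have hint2 : Integrable (fun w : (ℝ × ℝ) × ℝ => (w.2 - μX) ^ 2) P3 := by
    rw [← hlaw] at hgint
    exact hgint.comp_measurable measurable_snd
  have hval2 : ∫ w : (ℝ × ℝ) × ℝ, (w.2 - μX) ^ 2 ∂P3 = σX ^ 2 := by
    rw [← hgval, ← hlaw, integral_map measurable_snd.aemeasurable (by fun_prop)]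
  apply le_of_forall_gt_imp_ge_of_dense
  intro d hd
  have hd0 : 0 < d := hD0.trans_lt hd
  let g : (ℝ × ℝ) × ℝ → ℝ := fun w => -(w.2 - m w.1.2) ^ 2 / (2 * d)
    + (w.2 - μX) ^ 2 / (2 * σX ^ 2) + (Real.log σX - Real.log d / 2)
  have hgm : Measurable g := by fun_prop
  have i1 : Integrable (fun w : (ℝ × ℝ) × ℝ => -(w.2 - m w.1.2) ^ 2 / (2 * d)) P3 :=
    hint.neg.div_const _
  have i2 : Integrable (fun w : (ℝ × ℝ) × ℝ => (w.2 - μX) ^ 2 / (2 * σX ^ 2)) P3 :=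
    hint2.div_const _
  have hgi : Integrable g P3 := (i1.add i2).add (integrable_const _)
  have hgv : ∫ w, g w ∂P3 = -D / (2 * d) + 1 / 2 + (Real.log σX - Real.log d / 2) := by
    simp only [g]
    rw [integral_add (by exact i1.add i2) (integrable_const _), integral_add i1 i2,
      integral_div, integral_div, integral_neg, hval2]
    simp
    field_simp
    rw [hD]
  have hQ : ∫⁻ w, ENNReal.ofReal (Real.exp (g w))
      ∂((pA.prod pU) ⊗ₘ κ.comap Prod.fst measurable_fst) ≤ 1 := by
    rw [Measure.lintegral_compProd (by fun_prop), lintegral_prod_symm]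
    · apply le_of_eq
      calc _ = ∫⁻ u, ∫⁻ x, ENNReal.ofReal (Real.exp (-(x - m u) ^ 2 / (2 * d)
              + (x - μX) ^ 2 / (2 * σX ^ 2) + (Real.log σX - Real.log d / 2)))
              ∂(gauss μX σX) ∂pU := by
            apply lintegral_congr
            intro u
            rw [← hG, Measure.lintegral_bind κ.aemeasurable (by fun_prop)]
            rfl
        _ = ∫⁻ u, 1 ∂pU := by
            apply lintegral_congr
            intro u
            rw [gauss_eq, gaussianReal_of_var_ne_zero _ hv,
              lintegral_withDensity_eq_lintegral_mul _ (measurable_gaussianPDF _ _) (by fun_prop)]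
            have hd' : Real.toNNReal d ≠ 0 := (Real.toNNReal_pos.mpr hd0).ne'
            rw [← lintegral_gaussianPDF_eq_one (m u) hd']
            apply lintegral_congr
            intro x
            rw [Pi.mul_apply, mul_comm]
            exact core_pdf μX σX d (m u) x hσ hd0
        _ = 1 := by simp
    · exact (Measurable.lintegral_kernel_prod_right'
        (κ := κ.comap Prod.fst (measurable_fst : Measurable (Prod.fst : ℝ × ℝ → ℝ)))
        (f := fun w => ENNReal.ofReal (Real.exp (g w))) (by fun_prop)).aemeasurable
  have hdv := dv_aux P (pA.prod pU) _ hac.1 hac.2 g hgm hgi hQ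
  rw [← hP3, hgv] at hdv
  have hDd : D / (2 * d) ≤ 1 / 2 := by
    rw [div_le_iff₀ (by positivity)]; linarith
  have hfin : 2 * Real.log σX - 2 * R.toReal ≤ Real.log d := by
    rw [neg_div] at hdv; linarith
  have : σX ^ 2 * expNeg R ^ 2 = Real.exp (2 * Real.log σX - 2 * R.toReal) := by
    rw [expNeg, if_neg hRt, sub_eq_add_neg, Real.exp_add]
    congr 1
    · rw [two_mul, Real.exp_add, Real.exp_log hσ, sq]
    · rw [← Real.exp_nat_mul]; congr 1; push_cast; ring
  rw [this, ← Real.exp_log hd0]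
  exact Real.exp_le_exp.mpr hfin

lemma attain (σX : ℝ) (hσX : 0 < σX) (R Rc : ℝ≥0∞) (P : ℝ) :
    ∃ s ∈ Set.Icc (max (σX - Real.sqrt P) 0) σX,
      DlowerPrimeFun σX R Rc P s = DlowerPrime σX R Rc P ∧
      ∀ t ∈ Set.Icc (max (σX - Real.sqrt P) 0) σX,
        DlowerPrime σX R Rc P ≤ DlowerPrimeFun σX R Rc P t := by
  have hne : (Set.Icc (max (σX - Real.sqrt P) 0) σX).Nonempty :=
    Set.nonempty_Icc.mpr (max_le (by linarith [Real.sqrt_nonneg P]) hσX.le)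
  have hlsc : LowerSemicontinuousOn (DlowerPrimeFun σX R Rc P)
      (Set.Icc (max (σX - Real.sqrt P) 0) σX) := by
    have heq : DlowerPrimeFun σX R Rc P = fun s => ⨆ α : Set.Ioi (0 : ℝ),
        (σX ^ 2 + s ^ 2 - 2 * σX * Real.sqrt ((1 - expNeg (2 * R)) *
          (s ^ 2 - deltaPlus σX R Rc P s α ^ 2))) := by
      funext s
      rw [DlowerPrimeFun, sSup_image']
    rw [heq]
    apply lowerSemicontinuousOn_ciSup
    · intro s _
      refine ⟨σX ^ 2 + s ^ 2, ?_⟩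
      rintro _ ⟨α, rfl⟩
      dsimp only
      have := Real.sqrt_nonneg ((1 - expNeg (2 * R)) *
          (s ^ 2 - deltaPlus σX R Rc P s α ^ 2))
      have := mul_nonneg (mul_nonneg zero_le_two hσX.le) this
      linarith
    · intro α
      apply ContinuousOn.lowerSemicontinuousOn
      apply Continuous.continuousOn
      unfold deltaPlus
      fun_prop
  obtain ⟨s, hs, hmin⟩ := hlsc.exists_isMinOn hne isCompact_Icc
  have hle : IsLeast (DlowerPrimeFun σX R Rc P '' Set.Icc (max (σX - Real.sqrt P) 0) σX)
      (DlowerPrimeFun σX R Rc P s) := by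
    refine ⟨⟨s, hs, rfl⟩, ?_⟩
    rintro _ ⟨t, ht, rfl⟩
    exact hmin ht
  have h1 : DlowerPrimeFun σX R Rc P s = DlowerPrime σX R Rc P := hle.csInf_eq.symm
  exact ⟨s, hs, h1, fun t ht => h1 ▸ hmin ht⟩

lemma expNeg_nonneg (x : ℝ≥0∞) : 0 ≤ expNeg x := by
  unfold expNeg; split_ifs
  · exact le_rfl
  · exact (Real.exp_pos _).le

lemma expNeg_le_one (x : ℝ≥0∞) : expNeg x ≤ 1 := by
  unfold expNeg; split_ifs
  · exact zero_le_one
  · rw [Real.exp_le_one_iff]; simp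

lemma expNeg_two_mul (x : ℝ≥0∞) : expNeg (2 * x) = expNeg x ^ 2 := by
  by_cases h : x = ⊤
  · simp [expNeg, h]
  · have h2 : (2 : ℝ≥0∞) * x ≠ ⊤ := ENNReal.mul_ne_top (by simp) h
    rw [expNeg, expNeg, if_neg h, if_neg h2, ← Real.exp_nat_mul, ENNReal.toReal_mul]
    congr 1
    push_cast
    simp

lemma numeric_small (σX : ℝ) (hσX : 0 < σX) (R Rc : ℝ≥0∞) (P s M C Dist : ℝ)
    (hM0 : 0 ≤ M)
    (hD : σX ^ 2 + s ^ 2 - 2 * C ≤ Dist)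
    (hC : C ≤ σX * √((1 - expNeg (2 * R)) * (s ^ 2 - M)))
    (hK : ∀ ε > 0, ∃ K, σX ^ 2 + s ^ 2 - 2 * K ≤ P + ε ∧
      ∀ α > 0, σX * expNeg (R + Rc) ≤ α * √M + √(σX ^ 2 - 2 * α * K + α ^ 2 * s ^ 2)) :
    DlowerPrimeFun σX R Rc P s ≤ Dist := by
  apply csSup_le (Set.Nonempty.image _ ⟨1, by simp⟩)
  rintro _ ⟨α, hα, rfl⟩
  have hα : 0 < α := hα
  dsimp only
  have key : ∀ ε > 0, σX * expNeg (R + Rc) - α * √M ≤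
      √(σX ^ 2 - α * (σX ^ 2 + s ^ 2 - (P + ε)) + α ^ 2 * s ^ 2) := by
    intro ε hε
    obtain ⟨K, hK1, hK2⟩ := hK ε hε
    have h := hK2 α hα
    have : √(σX ^ 2 - 2 * α * K + α ^ 2 * s ^ 2) ≤
        √(σX ^ 2 - α * (σX ^ 2 + s ^ 2 - (P + ε)) + α ^ 2 * s ^ 2) := by
      apply Real.sqrt_le_sqrt
      nlinarith
    linarith
  have key0 : σX * expNeg (R + Rc) - α * √M ≤
      √(σX ^ 2 - α * (σX ^ 2 + s ^ 2 - P) + α ^ 2 * s ^ 2) := by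
    have hcont : Continuous fun ε : ℝ =>
        √(σX ^ 2 - α * (σX ^ 2 + s ^ 2 - (P + ε)) + α ^ 2 * s ^ 2) := by fun_prop
    have ht := (hcont.tendsto 0).mono_left (nhdsWithin_le_nhds (s := Set.Ioi 0))
    rw [add_zero] at ht
    apply ge_of_tendsto ht
    filter_upwards [self_mem_nhdsWithin] with ε hε
    exact key ε hε
  have hδ : deltaPlus σX R Rc P s α ≤ √M := by
    rw [deltaPlus, div_le_iff₀ hα]
    apply max_le
    · linarith
    · positivity
  have hδ0 : 0 ≤ deltaPlus σX R Rc P s α := by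
    rw [deltaPlus]; positivity
  have hδ2 : deltaPlus σX R Rc P s α ^ 2 ≤ M := by
    calc _ ≤ √M ^ 2 := by gcongr
      _ = M := Real.sq_sqrt hM0
  have he := expNeg_le_one (2 * R)
  have hsq : √((1 - expNeg (2 * R)) * (s ^ 2 - M)) ≤
      √((1 - expNeg (2 * R)) * (s ^ 2 - deltaPlus σX R Rc P s α ^ 2)) := by
    apply Real.sqrt_le_sqrt
    apply mul_le_mul_of_nonneg_left <;> linarith
  have := mul_le_mul_of_nonneg_left hsq hσX.le
  linarith

lemma numeric (σX : ℝ) (hσX : 0 < σX) (R Rc : ℝ≥0∞) (P s M C Dist : ℝ)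
    (hs : 0 ≤ s) (hM0 : 0 ≤ M)
    (hD : σX ^ 2 + s ^ 2 - 2 * C ≤ Dist)
    (hC : C ≤ σX * √((1 - expNeg (2 * R)) * (s ^ 2 - M)))
    (hK : ∀ ε > 0, ∃ K, K ≤ σX * s ∧ σX ^ 2 + s ^ 2 - 2 * K ≤ P + ε ∧
      ∀ α > 0, σX * expNeg (R + Rc) ≤ α * √M + √(σX ^ 2 - 2 * α * K + α ^ 2 * s ^ 2)) :
    DlowerPrime σX R Rc P ≤ Dist := by
  obtain ⟨s0, _, _, hmin⟩ := attain σX hσX R Rc P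
  rcases le_or_gt s σX with hsσ | hsσ
  · refine (hmin s ⟨max_le ?_ hs, hsσ⟩).trans
      (numeric_small σX hσX R Rc P s M C Dist hM0 hD hC
        (fun ε hε => let ⟨K, _, h⟩ := hK ε hε; ⟨K, h⟩))
    have h1 : (σX - s) ^ 2 ≤ P := by
      apply le_of_forall_pos_le_add
      intro ε hε
      obtain ⟨K, h1, h2, _⟩ := hK ε hε
      nlinarith
    have := Real.le_sqrt_of_sq_le h1
    linarith
  · have hs0 : 0 < s := hσX.trans hsσ
    have hmem : σX ∈ Set.Icc (max (σX - √P) 0) σX :=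
      ⟨max_le (by linarith [Real.sqrt_nonneg P]) hσX.le, le_rfl⟩
    set c := σX / s with hc
    have hc0 : 0 < c := by positivity
    have hcs : c * s = σX := by rw [hc]; field_simp
    have hc1 : c ≤ 1 := by rw [hc, div_le_one hs0]; exact hsσ.le
    have aux : ∀ K, K ≤ σX * s → 2 * K * (1 - c) ≤ s ^ 2 - σX ^ 2 := by
      intro K hKs
      have h1 : K * (1 - c) ≤ σX * s * (1 - c) :=
        mul_le_mul_of_nonneg_right hKs (by linarith)
      have h2 : σX * s * (1 - c) = σX * (s - σX) := by
        rw [← hcs]; ring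
      nlinarith
    have he := expNeg_le_one (2 * R)
    have he0 := expNeg_nonneg (2 * R)
    have hCs : C ≤ σX * s := by
      refine hC.trans (mul_le_mul_of_nonneg_left ?_ hσX.le)
      apply Real.sqrt_le_iff.mpr ⟨hs, ?_⟩
      nlinarith [mul_nonneg (sub_nonneg.mpr he) hM0, mul_nonneg he0 (sq_nonneg s)]
    refine (hmin σX hmem).trans
      (numeric_small σX hσX R Rc P σX (c ^ 2 * M) (c * C) Dist (by positivity) ?_ ?_ ?_)
    · have := aux C hCs
      linarith
    · have e : (1 - expNeg (2 * R)) * (σX ^ 2 - c ^ 2 * M) =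
          c ^ 2 * ((1 - expNeg (2 * R)) * (s ^ 2 - M)) := by rw [← hcs]; ring
      rw [e, Real.sqrt_mul (by positivity), Real.sqrt_sq hc0.le]
      have := mul_le_mul_of_nonneg_left hC hc0.le
      linarith
    · intro ε hε
      obtain ⟨K, h1, h2, h3⟩ := hK ε hε
      refine ⟨c * K, ?_, ?_⟩
      · have := aux K h1
        linarith
      · intro α hα
        have h := h3 (α * c) (by positivity)
        rw [Real.sqrt_mul (by positivity), Real.sqrt_sq hc0.le]
        have e : σX ^ 2 - 2 * α * (c * K) + α ^ 2 * σX ^ 2 =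
            σX ^ 2 - 2 * (α * c) * K + (α * c) ^ 2 * s ^ 2 := by
          have : σX ^ 2 = c ^ 2 * s ^ 2 := by rw [← hcs]; ring
          rw [mul_pow α c 2, mul_assoc (α ^ 2), ← this]; ring
        rw [e]
        linarith

lemma int_sub_sq {Ω : Type*} [MeasurableSpace Ω] {μ : Measure Ω} {f g : Ω → ℝ}
    (hf : MemLp f 2 μ) (hg : MemLp g 2 μ) (t : ℝ) :
    ∫ w, (f w - t * g w) ^ 2 ∂μ =
      ∫ w, f w ^ 2 ∂μ - 2 * t * ∫ w, f w * g w ∂μ + t ^ 2 * ∫ w, g w ^ 2 ∂μ := by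
  have i1 := hf.integrable_sq
  have i2 := hg.integrable_sq
  have i3 : Integrable (fun w => f w * g w) μ := hf.integrable_mul hg
  have i4 : Integrable (fun w => f w ^ 2 - 2 * t * (f w * g w)) μ := i1.sub (i3.const_mul _)
  rw [← integral_const_mul, ← integral_const_mul, ← integral_sub i1 (i3.const_mul _),
    ← integral_add i4 (i2.const_mul _)]
  congr 1
  funext w
  ring

lemma cs_int {Ω : Type*} [MeasurableSpace Ω] {μ : Measure Ω} {f g : Ω → ℝ}
    (hf : MemLp f 2 μ) (hg : MemLp g 2 μ) :
    ∫ w, f w * g w ∂μ ≤ √(∫ w, f w ^ 2 ∂μ) * √(∫ w, g w ^ 2 ∂μ) := by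
  have h : ∀ t : ℝ, 0 ≤ (∫ w, g w ^ 2 ∂μ) * (t * t) + (-2 * ∫ w, f w * g w ∂μ) * t
      + ∫ w, f w ^ 2 ∂μ := by
    intro t
    have h1 : 0 ≤ ∫ w, (f w - t * g w) ^ 2 ∂μ := integral_nonneg fun w => sq_nonneg _
    rw [int_sub_sq hf hg] at h1
    linarith
  have hd := discrim_le_zero h
  rw [discrim] at hd
  rw [← Real.sqrt_mul (integral_nonneg fun w => sq_nonneg _)]
  apply Real.le_sqrt_of_sq_le
  linarith

lemma mink_int {Ω : Type*} [MeasurableSpace Ω] {μ : Measure Ω} {f g : Ω → ℝ}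
    (hf : MemLp f 2 μ) (hg : MemLp g 2 μ) :
    √(∫ w, (f w + g w) ^ 2 ∂μ) ≤ √(∫ w, f w ^ 2 ∂μ) + √(∫ w, g w ^ 2 ∂μ) := by
  have h := int_sub_sq hf hg (-1)
  have hc := cs_int hf hg
  have e : ∀ w, (f w - -1 * g w) ^ 2 = (f w + g w) ^ 2 := fun w => by ring
  simp only [e] at h
  apply Real.sqrt_le_iff.mpr ⟨by positivity, ?_⟩
  have h1 := Real.sq_sqrt (integral_nonneg (μ := μ) (f := fun w => f w ^ 2) fun w => sq_nonneg _)
  have h2 := Real.sq_sqrt (integral_nonneg (μ := μ) (f := fun w => g w ^ 2) fun w => sq_nonneg _)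
  rw [h]
  nlinarith

lemma cond_one {Ω : Type*} [mΩ : MeasurableSpace Ω] (μ : Measure Ω) [IsProbabilityMeasure μ]
    (m : MeasurableSpace Ω) (hm : m ≤ mΩ) {f g h : Ω → ℝ} (hf : MemLp f 2 μ) (hg : MemLp g 2 μ)
    (hgm : StronglyMeasurable[m] g) (hh : μ[f | m] =ᵐ[μ] h) :
    ∫ w, f w * g w ∂μ = ∫ w, h w * g w ∂μ := by
  have h1 := condExp_mul_of_stronglyMeasurable_right hgm (hf.integrable_mul hg)
    (hf.integrable one_le_two)
  calc ∫ w, f w * g w ∂μ = ∫ w, (μ[f * g | m]) w ∂μ := (integral_condExp hm).symm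
    _ = ∫ w, h w * g w ∂μ := by
      apply integral_congr_ae
      filter_upwards [h1, hh] with w h1 h2
      rw [h1, Pi.mul_apply, h2]

lemma cond_sq {Ω : Type*} [mΩ : MeasurableSpace Ω] (μ : Measure Ω) [IsProbabilityMeasure μ]
    {f U : Ω → ℝ} (hU : Measurable U) (hf : MemLp f 2 μ) :
    ∃ a : ℝ → ℝ, Measurable a ∧ (a = fun u => ∫ y, y ∂(condDistrib f U μ u)) ∧
      (μ[f | MeasurableSpace.comap U inferInstance] =ᵐ[μ] fun w => a (U w)) ∧
      MemLp (fun w => a (U w)) 2 μ ∧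
      ∫ w, (f w - a (U w)) ^ 2 ∂μ = ∫ w, f w ^ 2 ∂μ - ∫ w, a (U w) ^ 2 ∂μ := by
  have ha : Measurable (fun u => ∫ y, y ∂(condDistrib f U μ u)) :=
    (StronglyMeasurable.integral_condDistrib (Y := f) (X := U) (μ := μ)
      (f := fun p : ℝ × ℝ => p.2) measurable_snd.stronglyMeasurable).measurable
  refine ⟨_, ha, rfl, ?_⟩
  have h1 := condExp_ae_eq_integral_condDistrib' hU (hf.integrable one_le_two)
  have h2 : MemLp (fun w => ∫ y, y ∂(condDistrib f U μ (U w))) 2 μ :=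
    (memLp_congr_ae h1).mp (hf.condExp one_le_two)
  refine ⟨h1, h2, ?_⟩
  have h3 : ∫ w, f w * (∫ y, y ∂(condDistrib f U μ (U w))) ∂μ =
      ∫ w, (∫ y, y ∂(condDistrib f U μ (U w))) * (∫ y, y ∂(condDistrib f U μ (U w))) ∂μ := by
    apply cond_one μ _ hU.comap_le hf h2 _ h1
    exact (ha.comp (Measurable.of_comap_le le_rfl)).stronglyMeasurable
  have h4 := int_sub_sq hf h2 1
  simp only [one_mul] at h4
  rw [h4, h3]
  simp only [← sq]
  ring

lemma cond_facts {Ω : Type*} [mΩ : MeasurableSpace Ω] [StandardBorelSpace Ω] (μ : Measure Ω)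
    [IsProbabilityMeasure μ] {f g U : Ω → ℝ} (hfm : Measurable f) (hgm : Measurable g)
    (hU : Measurable U) (hf : MemLp f 2 μ) (hg : MemLp g 2 μ)
    (hci : CondIndepFun (MeasurableSpace.comap U inferInstance) hU.comap_le f g μ) :
    ∃ a b : ℝ → ℝ, Measurable a ∧ Measurable b ∧
      MemLp (fun w => a (U w)) 2 μ ∧ MemLp (fun w => b (U w)) 2 μ ∧
      ∫ w, f w * g w ∂μ = ∫ w, a (U w) * b (U w) ∂μ ∧
      ∫ w, (f w - a (U w)) ^ 2 ∂μ = ∫ w, f w ^ 2 ∂μ - ∫ w, a (U w) ^ 2 ∂μ ∧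
      ∫ w, (g w - b (U w)) ^ 2 ∂μ = ∫ w, g w ^ 2 ∂μ - ∫ w, b (U w) ^ 2 ∂μ := by
  obtain ⟨a, ha, haeq, hac, haL, has⟩ := cond_sq μ hU hf
  obtain ⟨b, hb, hbeq, hbc, hbL, hbs⟩ := cond_sq μ hU hg
  refine ⟨a, b, ha, hb, haL, hbL, ?_, has, hbs⟩
  have hUg : Measurable (fun w => (U w, g w)) := hU.prodMk hgm
  have hker := (condIndepFun_iff_condDistrib_prod_ae_eq_prodMkRight hfm hgm hU).mp hci.symm
  have h1 := condExp_ae_eq_integral_condDistrib' hUg (hf.integrable one_le_two)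
  have h2 : μ[f | MeasurableSpace.comap (fun w => (U w, g w)) inferInstance] =ᵐ[μ]
      fun w => a (U w) := by
    refine h1.trans ?_
    filter_upwards [ae_of_ae_map hUg.aemeasurable hker] with w hw
    rw [hw, haeq, Kernel.prodMkRight_apply]
  have h3 : ∫ w, f w * g w ∂μ = ∫ w, a (U w) * g w ∂μ := by
    apply cond_one μ _ hUg.comap_le hf hg _ h2
    have : Measurable[MeasurableSpace.comap (fun w => (U w, g w)) inferInstance]
      (fun w => (U w, g w)) := Measurable.of_comap_le le_rfl
    exact (measurable_snd.comp this).stronglyMeasurable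
  have h4 : ∫ w, g w * a (U w) ∂μ = ∫ w, b (U w) * a (U w) ∂μ := by
    apply cond_one μ _ hU.comap_le hg haL _ hbc
    exact (ha.comp (Measurable.of_comap_le le_rfl)).stronglyMeasurable
  rw [h3]
  simp only [mul_comm (a _)]
  exact h4

lemma memLp_of_lint {Ω : Type*} [MeasurableSpace Ω] {μ : Measure Ω} {h : Ω → ℝ}
    (hm : Measurable h) (hh : ∫⁻ w, ENNReal.ofReal (h w ^ 2) ∂μ < ⊤) : MemLp h 2 μ := by
  rw [memLp_two_iff_integrable_sq hm.aestronglyMeasurable]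
  refine ⟨(hm.pow_const 2).aestronglyMeasurable, ?_⟩
  rw [hasFiniteIntegral_iff_ofReal (Filter.Eventually.of_forall fun w => sq_nonneg _)]
  exact hh

/-- Pull back an `L²` function along a map. -/
lemma memLp_pull {Ω Ω' : Type*} [MeasurableSpace Ω] [MeasurableSpace Ω'] {μ : Measure Ω}
    {ν : Measure Ω'} {T : Ω → Ω'} (hT : Measurable T) (hν : μ.map T = ν) {h : Ω' → ℝ}
    (hm : MemLp h 2 ν) : MemLp (fun w => h (T w)) 2 μ := by
  subst hν
  exact hm.comp_of_map hT.aemeasurable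

lemma int_pull {Ω Ω' : Type*} [MeasurableSpace Ω] [MeasurableSpace Ω'] {μ : Measure Ω}
    {ν : Measure Ω'} {T : Ω → Ω'} (hT : Measurable T) (hν : μ.map T = ν) {h : Ω' → ℝ}
    (hm : Measurable h) : ∫ w, h (T w) ∂μ = ∫ v, h v ∂ν := by
  subst hν
  rw [integral_map hT.aemeasurable hm.aestronglyMeasurable]

lemma center_le {Ω : Type*} [MeasurableSpace Ω] {μ : Measure Ω} [IsProbabilityMeasure μ]
    {X Y : Ω → ℝ} (hX : MemLp X 2 μ) (hY : MemLp Y 2 μ) (a b : ℝ)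
    (ha : ∫ w, X w ∂μ = a) (hb : ∫ w, Y w ∂μ = b) :
    ∫ w, (X w - a) ^ 2 ∂μ + ∫ w, (Y w - b) ^ 2 ∂μ - 2 * ∫ w, (X w - a) * (Y w - b) ∂μ
      ≤ ∫ w, (X w - Y w) ^ 2 ∂μ := by
  have hf : MemLp (fun w => X w - a) 2 μ := hX.sub (memLp_const a)
  have hg : MemLp (fun w => Y w - b) 2 μ := hY.sub (memLp_const b)
  have hXi := hX.integrable one_le_two
  have hYi := hY.integrable one_le_two
  have h1 := int_sub_sq hf hg 1
  have hfg : MemLp (fun w => X w - Y w) 2 μ := hX.sub hY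
  have h2 := int_sub_sq hfg (memLp_const (μ := μ) (p := 2) (1 : ℝ)) (a - b)
  have h3 : ∫ w, (X w - Y w) * 1 ∂μ = a - b := by
    simp only [mul_one]
    rw [integral_sub hXi hYi, ha, hb]
  have h4 : ∀ w, (X w - Y w - (a - b) * 1) ^ 2 = (X w - a - 1 * (Y w - b)) ^ 2 :=
    fun w => by ring
  simp only [h4] at h2
  rw [h1, h3] at h2
  simp only [one_pow, integral_const, probReal_univ, smul_eq_mul] at h2
  nlinarith [sq_nonneg (a - b)]

lemma coupling_bound (μX σX : ℝ) (hσ : 0 < σX) (Q : Measure (ℝ × ℝ)) (pY pU : Measure ℝ)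
    [IsProbabilityMeasure Q] [IsProbabilityMeasure pY] [IsProbabilityMeasure pU]
    (hQ : Q.map Prod.fst = pY) (cpl : Measure (ℝ × ℝ)) [IsProbabilityMeasure cpl]
    (h1 : cpl.map Prod.fst = gauss μX σX) (h2 : cpl.map Prod.snd = pY)
    (hY : MemLp (fun y => y) 2 pY) (R : ℝ≥0∞) (hR : KLD Q (pY.prod pU) ≤ R)
    (b : ℝ → ℝ) (hb : Measurable b) (hbL : MemLp (fun w : ℝ × ℝ => b w.2) 2 Q)
    (μh s M T : ℝ) (hμh : ∫ y, y ∂pY = μh) (hs : 0 ≤ s) (hs2 : ∫ y, (y - μh) ^ 2 ∂pY = s ^ 2)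
    (hM : ∫ w : ℝ × ℝ, (w.1 - μh - b w.2) ^ 2 ∂Q = M)
    (hT : ∫ w : ℝ × ℝ, (w.1 - w.2) ^ 2 ∂cpl ≤ T) :
    ∃ K, K ≤ σX * s ∧ σX ^ 2 + s ^ 2 - 2 * K ≤ T ∧ ∀ α > 0,
      σX * expNeg R ≤ α * √M + √(σX ^ 2 - 2 * α * K + α ^ 2 * s ^ 2) := by
  have hρp : IsProbabilityMeasure (cpl.map Prod.swap) :=
    Measure.isProbabilityMeasure_map measurable_swap.aemeasurable
  set ρ := cpl.map Prod.swap with hρ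
  have hρf : ρ.fst = pY := by
    rw [Measure.fst, hρ, Measure.map_map measurable_fst measurable_swap, ← h2]
    rfl
  have hρs : ρ.snd = gauss μX σX := by
    rw [Measure.snd, hρ, Measure.map_map measurable_snd measurable_swap, ← h1]
    rfl
  set κ := ρ.condKernel with hκ
  have hdis : pY ⊗ₘ κ = ρ := by
    rw [← hρf]
    exact ρ.disintegrate κ
  have hG : pY.bind κ = gauss μX σX := by
    rw [← hρs, ← hdis, Measure.snd_compProd]
  set P3 := Q ⊗ₘ κ.comap Prod.fst measurable_fst with hP3
  have hP3f : P3.map Prod.fst = Q := Measure.fst_compProd _ _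
  have hpair : Measurable (fun w : (ℝ × ℝ) × ℝ => (w.1.1, w.2)) := by fun_prop
  have hP3ρ : P3.map (fun w => (w.1.1, w.2)) = ρ := by
    rw [← hdis]
    ext A hA
    rw [Measure.map_apply hpair hA, hP3, Measure.compProd_apply (hpair hA),
      Measure.compProd_apply hA, ← hQ,
      lintegral_map (Kernel.measurable_kernel_prodMk_left hA) measurable_fst]
    rfl
  have hmX : Measurable (fun w : (ℝ × ℝ) × ℝ => w.2) := measurable_snd
  have hmY : Measurable (fun w : (ℝ × ℝ) × ℝ => w.1.1) := by fun_prop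
  have hP3X : P3.map (fun w => w.2) = gauss μX σX := by
    rw [← hρs, ← hP3ρ, Measure.snd, Measure.map_map measurable_snd hpair]
    rfl
  have hP3Y : P3.map (fun w => w.1.1) = pY := by
    rw [← hQ, ← hP3f, Measure.map_map measurable_fst measurable_fst]
    rfl
  have hXL : MemLp (fun w : (ℝ × ℝ) × ℝ => w.2) 2 P3 :=
    memLp_pull hmX hP3X (gauss_memLp μX σX)
  have hYL : MemLp (fun w : (ℝ × ℝ) × ℝ => w.1.1) 2 P3 := memLp_pull hmY hP3Y hY
  have hBL : MemLp (fun w : (ℝ × ℝ) × ℝ => b w.1.2) 2 P3 :=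
    memLp_pull measurable_fst hP3f hbL
  have hXm : ∫ w, w.2 ∂P3 = μX := by
    rw [int_pull hmX hP3X (h := fun x => x) measurable_id]
    exact gauss_mean μX σX
  have hYm : ∫ w, w.1.1 ∂P3 = μh := by
    rw [int_pull hmY hP3Y (h := fun x => x) measurable_id, hμh]
  have hXv : ∫ w, (w.2 - μX) ^ 2 ∂P3 = σX ^ 2 := by
    rw [int_pull hmX hP3X (h := fun x => (x - μX) ^ 2) (by fun_prop)]
    exact gauss_var μX σX
  have hYv : ∫ w, (w.1.1 - μh) ^ 2 ∂P3 = s ^ 2 := by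
    rw [int_pull hmY hP3Y (h := fun x => (x - μh) ^ 2) (by fun_prop), hs2]
  have hBv : ∫ w, (w.1.1 - μh - b w.1.2) ^ 2 ∂P3 = M := by
    rw [int_pull measurable_fst hP3f (h := fun w => (w.1 - μh - b w.2) ^ 2) (by fun_prop), hM]
  have hTv : ∫ w, (w.2 - w.1.1) ^ 2 ∂P3 ≤ T := by
    rw [int_pull hpair hP3ρ (h := fun w => (w.2 - w.1) ^ 2) (by fun_prop),
      ← int_pull measurable_swap hρ.symm (h := fun w : ℝ × ℝ => (w.2 - w.1) ^ 2) (by fun_prop)]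
    exact hT
  have hf : MemLp (fun w : (ℝ × ℝ) × ℝ => w.2 - μX) 2 P3 := hXL.sub (memLp_const μX)
  have hg : MemLp (fun w : (ℝ × ℝ) × ℝ => w.1.1 - μh) 2 P3 := hYL.sub (memLp_const μh)
  refine ⟨∫ w, (w.2 - μX) * (w.1.1 - μh) ∂P3, ?_, ?_, ?_⟩
  · have := cs_int hf hg
    rwa [hXv, hYv, Real.sqrt_sq hσ.le, Real.sqrt_sq hs] at this
  · have := center_le hXL hYL μX μh hXm hYm
    rw [hXv, hYv] at this
    linarith
  · intro α hα
    have hm : Measurable (fun u => μX + α * b u) := by fun_prop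
    have hF : MemLp (fun w : (ℝ × ℝ) × ℝ => α * (w.1.1 - μh - b w.1.2)) 2 P3 :=
      (hg.sub hBL).const_mul α
    have hH : MemLp (fun w : (ℝ × ℝ) × ℝ => (w.2 - μX) - α * (w.1.1 - μh)) 2 P3 :=
      hf.sub (hg.const_mul α)
    have e : ∀ w : (ℝ × ℝ) × ℝ, α * (w.1.1 - μh - b w.1.2) + ((w.2 - μX) - α * (w.1.1 - μh)) =
        w.2 - (μX + α * b w.1.2) := fun w => by ring
    have hsum : MemLp (fun w : (ℝ × ℝ) × ℝ => w.2 - (μX + α * b w.1.2)) 2 P3 := by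
      have := hF.add hH
      refine this.ae_eq (Filter.Eventually.of_forall fun w => e w)
    have hcore := core_bound μX σX hσ Q pY pU hQ κ hG _ hm R hR hsum.integrable_sq
    have hmk := mink_int hF hH
    simp only [e, mul_pow] at hmk
    rw [integral_const_mul, hBv, Real.sqrt_mul (sq_nonneg _), Real.sqrt_sq hα.le,
      int_sub_sq hf hg, hXv, hYv] at hmk
    refine le_trans ?_ hmk
    apply Real.le_sqrt_of_sq_le
    rw [mul_pow]
    exact hcore

lemma source_bound (μX σX : ℝ) (hσ : 0 < σX) (Q : Measure (ℝ × ℝ)) (pU : Measure ℝ)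
    [IsProbabilityMeasure Q] [IsProbabilityMeasure pU]
    (hQ : Q.map Prod.fst = gauss μX σX) (R : ℝ≥0∞) (hR : KLD Q ((gauss μX σX).prod pU) ≤ R)
    (a : ℝ → ℝ) (ha : Measurable a) (haL : MemLp (fun w : ℝ × ℝ => a w.2) 2 Q) :
    σX ^ 2 * expNeg R ^ 2 ≤ ∫ w : ℝ × ℝ, (w.1 - μX - a w.2) ^ 2 ∂Q := by
  have hid : Q ⊗ₘ (Kernel.id : Kernel ℝ ℝ).comap Prod.fst measurable_fst =
      Q.map (fun w => (w, w.1)) := by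
    have : (Kernel.id : Kernel ℝ ℝ).comap (Prod.fst : ℝ × ℝ → ℝ)
        (measurable_fst : Measurable (Prod.fst : ℝ × ℝ → ℝ)) =
        Kernel.deterministic (Prod.fst : ℝ × ℝ → ℝ) (measurable_fst : Measurable (Prod.fst : ℝ × ℝ → ℝ)) := by
      ext x
      simp [Kernel.deterministic_apply]
    rw [this, Measure.compProd_deterministic]
  have hmp : Measurable (fun w : ℝ × ℝ => (w, w.1)) := by fun_prop
  have hm : Measurable (fun u => μX + a u) := by fun_prop
  have hXL : MemLp (fun w : ℝ × ℝ => w.1) 2 Q := memLp_pull measurable_fst hQ (gauss_memLp μX σX)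
  have hL : MemLp (fun w : ℝ × ℝ => w.1 - (μX + a w.2)) 2 Q :=
    hXL.sub ((memLp_const μX).add haL)
  have hint : Integrable (fun w : (ℝ × ℝ) × ℝ => (w.2 - (μX + a w.1.2)) ^ 2)
      (Q ⊗ₘ (Kernel.id : Kernel ℝ ℝ).comap Prod.fst measurable_fst) := by
    rw [hid, integrable_map_measure (by fun_prop) hmp.aemeasurable]
    exact hL.integrable_sq
  have := core_bound μX σX hσ Q (gauss μX σX) pU hQ Kernel.id Measure.id_comp _ hm R hR hint
  rw [hid, integral_map hmp.aemeasurable (by fun_prop)] at this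
  simpa only [sub_sub] using this

lemma main_bound (μX σX : ℝ) (hσX : 0 < σX) (R Rc : ℝ≥0∞) (P : ℝ) (hP : 0 ≤ P)
    (μ : Measure (ℝ × ℝ × ℝ))
    (hμ : DRPfeasible (gauss μX σX) W2sq R Rc (ENNReal.ofReal P) μ) :
    ENNReal.ofReal (DlowerPrime σX R Rc P) ≤ distortion μ := by
  obtain ⟨hprob, hX, hci, hI1, hI2, hW⟩ := hμ
  have mX : Measurable (fun w : ℝ × ℝ × ℝ => w.1) := measurable_fst
  have mU : Measurable (fun w : ℝ × ℝ × ℝ => w.2.1) := by fun_prop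
  have mY : Measurable (fun w : ℝ × ℝ × ℝ => w.2.2) := by fun_prop
  have hcpl : ∀ ε > 0, ∃ cpl : Measure (ℝ × ℝ), IsProbabilityMeasure cpl ∧
      cpl.map Prod.fst = gauss μX σX ∧ cpl.map Prod.snd = μ.map (fun w => w.2.2) ∧
      ∫⁻ w, ENNReal.ofReal ((w.1 - w.2) ^ 2) ∂cpl < ENNReal.ofReal (P + ε) := by
    intro ε hε
    have hlt : W2sq (gauss μX σX) (μ.map (fun w => w.2.2)) < ENNReal.ofReal (P + ε) :=
      lt_of_le_of_lt hW ((ENNReal.ofReal_lt_ofReal_iff (by linarith)).mpr (by linarith))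
    rw [W2sq] at hlt
    simp only [iInf_lt_iff] at hlt
    obtain ⟨cpl, h0, h1, h2, h3⟩ := hlt
    exact ⟨cpl, h0, h1, h2, h3⟩
  have pYprob : IsProbabilityMeasure (μ.map (fun w => w.2.2)) :=
    Measure.isProbabilityMeasure_map mY.aemeasurable
  have pUprob : IsProbabilityMeasure (μ.map (fun w => w.2.1)) :=
    Measure.isProbabilityMeasure_map mU.aemeasurable
  have hYL0 : MemLp (fun y => y) 2 (μ.map (fun w => w.2.2)) := by
    obtain ⟨cpl, h0, h1, h2, h3⟩ := hcpl 1 one_pos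
    have hd : MemLp (fun w : ℝ × ℝ => w.1 - w.2) 2 cpl :=
      memLp_of_lint (by fun_prop) (h3.trans ENNReal.ofReal_lt_top)
    have hx : MemLp (fun w : ℝ × ℝ => w.1) 2 cpl :=
      memLp_pull measurable_fst h1 (gauss_memLp μX σX)
    rw [← h2, memLp_map_measure_iff (by fun_prop) measurable_snd.aemeasurable]
    exact (hx.sub hd).ae_eq (Filter.Eventually.of_forall fun w => by simp)
  have hYL : MemLp (fun w : ℝ × ℝ × ℝ => w.2.2) 2 μ := memLp_pull mY rfl hYL0
  have hXL : MemLp (fun w : ℝ × ℝ × ℝ => w.1) 2 μ := memLp_pull mX hX (gauss_memLp μX σX)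
  obtain ⟨μh, hμh⟩ : ∃ m, ∫ w, w.2.2 ∂μ = m := ⟨_, rfl⟩
  have hXm : ∫ w, w.1 ∂μ = μX := by
    rw [int_pull mX hX (h := fun x => x) measurable_id]
    exact gauss_mean μX σX
  have hXv : ∫ w, (w.1 - μX) ^ 2 ∂μ = σX ^ 2 := by
    rw [int_pull mX hX (h := fun x => (x - μX) ^ 2) (by fun_prop)]
    exact gauss_var μX σX
  have hf : MemLp (fun w : ℝ × ℝ × ℝ => w.1 - μX) 2 μ := hXL.sub (memLp_const μX)
  have hg : MemLp (fun w : ℝ × ℝ × ℝ => w.2.2 - μh) 2 μ := hYL.sub (memLp_const μh)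
  have hci' : CondIndepFun (MeasurableSpace.comap (fun w : ℝ × ℝ × ℝ => w.2.1) inferInstance)
      mU.comap_le (fun w : ℝ × ℝ × ℝ => w.1 - μX) (fun w : ℝ × ℝ × ℝ => w.2.2 - μh) μ :=
    hci.comp (φ := fun x => x - μX) (ψ := fun x => x - μh) (by fun_prop) (by fun_prop)
  obtain ⟨a, b, ha, hb, haL, hbL, hab, hav, hbv⟩ :=
    cond_facts μ (by fun_prop) (by fun_prop) mU hf hg hci'
  have hs0 : 0 ≤ ∫ w, (w.2.2 - μh) ^ 2 ∂μ := integral_nonneg fun w => sq_nonneg _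
  obtain ⟨s, hs⟩ : ∃ s, s = √(∫ w, (w.2.2 - μh) ^ 2 ∂μ) := ⟨_, rfl⟩
  have hsn : 0 ≤ s := by rw [hs]; positivity
  have hs2 : ∫ w, (w.2.2 - μh) ^ 2 ∂μ = s ^ 2 := by rw [hs, Real.sq_sqrt hs0]
  obtain ⟨M, hM⟩ : ∃ M, ∫ w, (w.2.2 - μh - b w.2.1) ^ 2 ∂μ = M := ⟨_, rfl⟩
  have hM0 : 0 ≤ M := by rw [← hM]; exact integral_nonneg fun w => sq_nonneg _
  have hdist : distortion μ = ENNReal.ofReal (∫ w, (w.1 - w.2.2) ^ 2 ∂μ) := by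
    have hL : MemLp (fun w : ℝ × ℝ × ℝ => w.1 - w.2.2) 2 μ := hXL.sub hYL
    rw [distortion, ofReal_integral_eq_lintegral_ofReal hL.integrable_sq
      (Filter.Eventually.of_forall fun w => sq_nonneg _)]
  rw [hdist]
  apply ENNReal.ofReal_le_ofReal
  refine numeric σX hσX R Rc P s M (∫ w, (w.1 - μX) * (w.2.2 - μh) ∂μ) _ hsn hM0 ?_ ?_ ?_
  · have := center_le hXL hYL μX μh hXm hμh
    rwa [hXv, hs2] at this
  · have mXU : Measurable (fun w : ℝ × ℝ × ℝ => (w.1, w.2.1)) := by fun_prop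
    have hQp : IsProbabilityMeasure (μ.map (fun w => (w.1, w.2.1))) :=
      Measure.isProbabilityMeasure_map mXU.aemeasurable
    have hQf : (μ.map (fun w => (w.1, w.2.1))).map Prod.fst = gauss μX σX := by
      rw [Measure.map_map measurable_fst mXU, ← hX]
      rfl
    have hR : KLD (μ.map (fun w => (w.1, w.2.1)))
        ((gauss μX σX).prod (μ.map (fun w => w.2.1))) ≤ R := by
      rw [← hX]
      exact hI1
    have hLa : MemLp (fun w : ℝ × ℝ => a w.2) 2 (μ.map (fun w => (w.1, w.2.1))) := by
      exact (memLp_map_measure_iff (ha.comp measurable_snd).aestronglyMeasurable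
        mXU.aemeasurable).mpr haL
    have hsb := source_bound μX σX hσX _ _ hQf R hR a ha hLa
    rw [← int_pull mXU rfl (h := fun w : ℝ × ℝ => (w.1 - μX - a w.2) ^ 2) (by fun_prop)] at hsb
    simp only at hsb
    rw [hav, hXv] at hsb
    rw [hM, hs2] at hbv
    have hcs := cs_int haL hbL
    rw [hab]
    refine hcs.trans ?_
    have e1 : ∫ w, b w.2.1 ^ 2 ∂μ = s ^ 2 - M := by linarith
    rw [e1, expNeg_two_mul]
    have e2 : 0 ≤ 1 - expNeg R ^ 2 := by
      nlinarith [expNeg_nonneg R, expNeg_le_one R]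
    rw [Real.sqrt_mul e2, ← mul_assoc]
    apply mul_le_mul_of_nonneg_right _ (Real.sqrt_nonneg _)
    rw [← Real.sqrt_sq hσX.le, ← Real.sqrt_mul (sq_nonneg _)]
    apply Real.sqrt_le_sqrt
    linarith
  · intro ε hε
    obtain ⟨cpl, h0, h1, h2, h3⟩ := hcpl ε hε
    have mYU : Measurable (fun w : ℝ × ℝ × ℝ => (w.2.2, w.2.1)) := by fun_prop
    have hQp : IsProbabilityMeasure (μ.map (fun w => (w.2.2, w.2.1))) :=
      Measure.isProbabilityMeasure_map mYU.aemeasurable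
    have hQf : (μ.map (fun w => (w.2.2, w.2.1))).map Prod.fst = μ.map (fun w => w.2.2) := by
      rw [Measure.map_map measurable_fst mYU]
      rfl
    have hLb : MemLp (fun w : ℝ × ℝ => b w.2) 2 (μ.map (fun w => (w.2.2, w.2.1))) := by
      exact (memLp_map_measure_iff (hb.comp measurable_snd).aestronglyMeasurable
        mYU.aemeasurable).mpr hbL
    have hT : ∫ w : ℝ × ℝ, (w.1 - w.2) ^ 2 ∂cpl ≤ P + ε := by
      have hd : MemLp (fun w : ℝ × ℝ => w.1 - w.2) 2 cpl :=
        memLp_of_lint (by fun_prop) (h3.trans ENNReal.ofReal_lt_top)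
      rw [← ofReal_integral_eq_lintegral_ofReal hd.integrable_sq
        (Filter.Eventually.of_forall fun w => sq_nonneg _)] at h3
      exact (ENNReal.ofReal_le_ofReal_iff (by linarith)).mp h3.le
    refine coupling_bound μX σX hσX _ _ (μ.map (fun w => w.2.1)) hQf cpl h1 h2 hYL0 (R + Rc) hI2
      b hb hLb μh s M (P + ε) ?_ hsn ?_ ?_ hT
    · rw [← int_pull mY rfl (h := fun x => x) measurable_id, hμh]
    · rw [← int_pull mY rfl (h := fun x => (x - μh) ^ 2) (by fun_prop), hs2]
    · rw [← int_pull mYU rfl (h := fun w : ℝ × ℝ => (w.1 - μh - b w.2) ^ 2) (by fun_prop), hM]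

/-- The improved lower bound `D̲'(R,R_c,P|W₂²)` on the Gaussian DRP function,
with attainment of the minimum over `σ̂`. -/
theorem stmt8 (μX σX : ℝ) (hσX : 0 < σX) (R Rc : ℝ≥0∞) (P : ℝ) (hP : 0 ≤ P) :
    (∃ s ∈ Set.Icc (max (σX - Real.sqrt P) 0) σX,
      DlowerPrimeFun σX R Rc P s = DlowerPrime σX R Rc P) ∧
    DRP (gauss μX σX) W2sq R Rc (ENNReal.ofReal P) ≥
      ENNReal.ofReal (DlowerPrime σX R Rc P) := by
  obtain ⟨s, hs, hse, -⟩ := attain σX hσX R Rc P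
  exact ⟨⟨s, hs, hse⟩, le_iInf₂ fun μ hμ => main_bound μX σX hσX R Rc P hP μ hμ⟩
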